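/- arXiv:2502.05008 — 3 statements merged into one kernel-verified Lean document; each statement's English description precedes it below -/
import Mathlib

section
/- Let S be a set of linearization points and F : S → ℝ^{n×n}, H : S → ℝ^{p×n}. Suppose V_k ⊆ ℝ^n (k ∈ ℕ) are linear subspaces such that for every state s ∈ S and every k: V_k ⊆ ker(H(s)) and F(s) '' V_k ⊆ V_{k+1}. Then for every sequence x : ℕ → S of linearization points and every k, V_k is contained in the unobservable subspace along x: V_k ⊆ N(x,k). (This is the core of the proofs that the estimator's state-independent unobservable subspace is contained in that of the nominal linearized system, and of the sufficiency direction of the observability-matching condition.) -/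
open Matrix

/-- Ordered product `A_{k+ℓ-1} ⋯ A_k` of the state-propagation matrices,
with the empty product (`ℓ = 0`) equal to the identity. -/
def obsProd {n : ℕ} (A : ℕ → Matrix (Fin n) (Fin n) ℝ) : ℕ → ℕ → Matrix (Fin n) (Fin n) ℝ
  | _, 0 => 1
  | k, ℓ + 1 => A (k + ℓ) * obsProd A k ℓ

/-- The unobservable subspace at time `k` along a sequence `x` of linearization points:
`N(x,k) = ⋂_{ℓ ≥ 0} ker (H(x_{k+ℓ}) · F(x_{k+ℓ-1}) ⋯ F(x_k))`. -/
def unobsAlong {n q : ℕ} {S : Type*} (F : S → Matrix (Fin n) (Fin n) ℝ)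
    (H : S → Matrix (Fin q) (Fin n) ℝ) (x : ℕ → S) (k : ℕ) : Submodule ℝ (Fin n → ℝ) :=
  ⨅ ℓ : ℕ, LinearMap.ker
    (Matrix.mulVecLin (H (x (k + ℓ)) * obsProd (fun i => F (x i)) k ℓ))

/-- Subspaces that are forward-invariant under `A` at every time absorb the ordered products
of `A`. -/
theorem obsProd_mulVec_mem {n : ℕ} {A : ℕ → Matrix (Fin n) (Fin n) ℝ}
    {V : ℕ → Submodule ℝ (Fin n → ℝ)}
    (hA : ∀ i, Submodule.map (Matrix.mulVecLin (A i)) (V i) ≤ V (i + 1))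
    {k : ℕ} {v : Fin n → ℝ} (hv : v ∈ V k) (ℓ : ℕ) : obsProd A k ℓ *ᵥ v ∈ V (k + ℓ) := by
  induction ℓ with
  | zero => simpa [obsProd] using hv
  | succ ℓ ih =>
    rw [obsProd, ← Matrix.mulVec_mulVec]
    exact hA (k + ℓ) (Submodule.mem_map_of_mem ih)

/-- If the subspaces `V_k` lie in the kernel of the measurement Jacobian at every state and
are forward-invariant under the propagation Jacobian at every state, then `V_k` is contained
in the unobservable subspace along every sequence of linearization points. -/
theorem subspace_le_unobs_of_state_independent {n q : ℕ} {S : Type*}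
    (F : S → Matrix (Fin n) (Fin n) ℝ) (H : S → Matrix (Fin q) (Fin n) ℝ)
    (V : ℕ → Submodule ℝ (Fin n → ℝ))
    (hker : ∀ (s : S) (k : ℕ), V k ≤ LinearMap.ker (Matrix.mulVecLin (H s)))
    (hinv : ∀ (s : S) (k : ℕ), Submodule.map (Matrix.mulVecLin (F s)) (V k) ≤ V (k + 1)) :
    ∀ (x : ℕ → S) (k : ℕ), V k ≤ unobsAlong F H x k := by
  intro x k v hv
  refine (Submodule.mem_iInf _).2 fun ℓ => ?_
  rw [LinearMap.mem_ker, Matrix.mulVecLin_apply, ← Matrix.mulVec_mulVec]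
  exact hker (x (k + ℓ)) (k + ℓ) (obsProd_mulVec_mem (fun i => hinv (x i) i) hv ℓ)
end

section
/- Let S be a nonempty set of linearization points and F : S → ℝ^{n×n}, H : S → ℝ^{p×n}. Define the estimator unobservable subspace N̂_k := ⋂_{x : ℕ → S} N(x,k), the intersection over all sequences of linearization points. Then for every state s ∈ S and every k: (i) N̂_k ⊆ ker(H(s)), and (ii) F(s) '' N̂_k ⊆ N̂_{k+1}. (This expresses that the EKF estimator system's unobservable subspace, which must be preserved for arbitrary data-dependent linearization points, is state-independent: it lies in the kernel of the measurement Jacobian at every state and is forward-invariant under the propagation Jacobian at every state.) -/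
open Matrix

/-- The estimator unobservable subspace `N̂_k := ⋂_{x : ℕ → S} N(x,k)`. -/
def estUnobs {n q : ℕ} {S : Type*} (F : S → Matrix (Fin n) (Fin n) ℝ)
    (H : S → Matrix (Fin q) (Fin n) ℝ) (k : ℕ) : Submodule ℝ (Fin n → ℝ) :=
  ⨅ x : ℕ → S, unobsAlong F H x k

theorem obsProd_succ_eq_mul {n : ℕ} (A : ℕ → Matrix (Fin n) (Fin n) ℝ) (k ℓ : ℕ) :
    obsProd A k (ℓ + 1) = obsProd A (k + 1) ℓ * A k := by
  induction ℓ with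
  | zero => simp [obsProd]
  | succ ℓ ih =>
    rw [obsProd, ih, obsProd, Matrix.mul_assoc, Nat.add_right_comm, Nat.add_assoc]

theorem obsProd_congr {n : ℕ} {A B : ℕ → Matrix (Fin n) (Fin n) ℝ} {k : ℕ}
    (h : ∀ i, k ≤ i → A i = B i) (ℓ : ℕ) : obsProd A k ℓ = obsProd B k ℓ := by
  induction ℓ with
  | zero => rfl
  | succ ℓ ih => rw [obsProd, obsProd, ih, h _ (Nat.le_add_right k ℓ)]

theorem mem_estUnobs {n q : ℕ} {S : Type*} {F : S → Matrix (Fin n) (Fin n) ℝ}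
    {H : S → Matrix (Fin q) (Fin n) ℝ} {k : ℕ} {v : Fin n → ℝ} :
    v ∈ estUnobs F H k ↔ ∀ (x : ℕ → S) (ℓ : ℕ),
      (H (x (k + ℓ)) * obsProd (fun i => F (x i)) k ℓ) *ᵥ v = 0 := by
  simp [estUnobs, unobsAlong]

/-- The estimator unobservable subspace is state-independent: it lies in the kernel of the
measurement Jacobian at every state, and is forward-invariant under the propagation Jacobian
at every state. -/
theorem estUnobs_state_independent {n q : ℕ} {S : Type*} [Nonempty S]
    (F : S → Matrix (Fin n) (Fin n) ℝ) (H : S → Matrix (Fin q) (Fin n) ℝ) :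
    ∀ (s : S) (k : ℕ),
      estUnobs F H k ≤ LinearMap.ker (Matrix.mulVecLin (H s)) ∧
        Submodule.map (Matrix.mulVecLin (F s)) (estUnobs F H k) ≤ estUnobs F H (k + 1) := by
  refine fun s k => ⟨fun v hv => ?_, ?_⟩
  · simpa [obsProd] using mem_estUnobs.1 hv (fun _ => s) 0
  · rintro _ ⟨v, hv, rfl⟩
    refine mem_estUnobs.2 fun x ℓ => ?_
    have hx : ∀ i, k + 1 ≤ i → Function.update x k s i = x i := fun i hi =>
      Function.update_of_ne (by omega) s x
    have h := mem_estUnobs.1 hv (Function.update x k s) (ℓ + 1)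
    rw [obsProd_succ_eq_mul, hx _ (by omega), Function.update_self,
      obsProd_congr (fun i hi => congrArg F (hx i hi)), ← Matrix.mul_assoc,
      ← Matrix.mulVec_mulVec] at h
    rwa [Nat.add_assoc, Nat.add_comm 1 ℓ]
end

section
/- Let S be a nonempty set, F : S → ℝ^{n×n}, H : S → ℝ^{p×n}, and let T : S → ℝ^{n×n} take invertible values. Assume the transformation renders the propagation Jacobian constant: there is a matrix C ∈ ℝ^{n×n} with T(s′)·F(s)·T(s)^{-1} = C for all s, s′ ∈ S. Define the transformed measurement Jacobian H̄(s) := H(s)·T(s)^{-1}, and for a sequence x : ℕ → S define the transformed unobservable subspace N̄(x,k) := ⋂_{ℓ≥0} ker(H̄(x_{k+ℓ})·(T(x_{k+ℓ})F(x_{k+ℓ−1})T(x_{k+ℓ−1})^{-1})⋯(T(x_{k+1})F(x_k)T(x_k)^{-1})). Then the intersection over all sequences satisfies ⋂_{x : ℕ → S} N̄(x,k) = ⋂_{ℓ≥0} ⋂_{s∈S} ker(H̄(s)·C^ℓ) for every k; in particular this estimator unobservable subspace of the transformed system is the same constant subspace at every time step. -/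
open Matrix

/-- For a constant family the ordered product is a power. -/
theorem obsProd_const {n : ℕ} (C : Matrix (Fin n) (Fin n) ℝ) (k ℓ : ℕ) :
    obsProd (fun _ => C) k ℓ = C ^ ℓ := by
  induction ℓ with
  | zero => simp [obsProd]
  | succ ℓ ih => rw [obsProd, ih, pow_succ']

/-- Transformation design approach 2: if the transformation `T` renders the propagation
Jacobian constant (`T(s′) F(s) T(s)⁻¹ = C` for all `s, s′`), then the estimator unobservable
subspace of the transformed system (`H̄(s) := H(s) T(s)⁻¹`, transformed propagation Jacobians
`T(x_{j+1}) F(x_j) T(x_j)⁻¹`), intersected over all sequences of linearization points, equals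
`⋂_{ℓ≥0} ⋂_{s∈S} ker (H̄(s) · C^ℓ)` at every time step `k`; in particular it is the same
constant subspace at every time step. -/
theorem transformed_estimator_unobs_constant {n q : ℕ} {S : Type*} [Nonempty S]
    (F T : S → Matrix (Fin n) (Fin n) ℝ) (H : S → Matrix (Fin q) (Fin n) ℝ)
    (hT : ∀ s, IsUnit (T s)) (C : Matrix (Fin n) (Fin n) ℝ)
    (hC : ∀ s s' : S, T s' * F s * (T s)⁻¹ = C) (k : ℕ) :
    (⨅ x : ℕ → S, ⨅ ℓ : ℕ, LinearMap.ker
        (Matrix.mulVecLin ((H (x (k + ℓ)) * (T (x (k + ℓ)))⁻¹)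
          * obsProd (fun i => T (x (i + 1)) * F (x i) * (T (x i))⁻¹) k ℓ)))
      = ⨅ ℓ : ℕ, ⨅ s : S, LinearMap.ker
          (Matrix.mulVecLin ((H s * (T s)⁻¹) * C ^ ℓ)) := by
  simp only [hC, obsProd_const]
  rw [iInf_comm]
  refine iInf_congr fun ℓ => ?_
  exact Function.Surjective.iInf_comp (f := fun x : ℕ → S => x (k + ℓ))
    (fun s => ⟨fun _ => s, rfl⟩)
    (fun s => LinearMap.ker (Matrix.mulVecLin ((H s * (T s)⁻¹) * C ^ ℓ)))
end
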